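/- Let X be a simplicial complex, q ≥ 2, and X_1, X_2 as above (covering hypotheses on (q−1)- and q-simplices, and no (q−1)-connection between X_1 and X_2). If z_1 is a (q−1)-cycle of X_1, z_2 is a (q−1)-cycle of X_2, and z_1 + z_2 = ∂A for a q-chain A of X, then z_1 = ∂(A ∩ X_1) and z_2 = ∂(A ∩ X_2). -/

import Mathlib

open scoped Classical

/-- An abstract simplicial complex on the vertex set `V`: a set of finite
simplices closed under taking subsets. -/
def IsComplex {V : Type*} (X : Set (Finset V)) : Prop :=
  ∀ s ∈ X, ∀ t : Finset V, t ⊆ s → t ∈ X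

/-- The `q`-simplices of `X` (of cardinality `q + 1`). -/
def simplices {V : Type*} (X : Set (Finset V)) (q : ℕ) : Set (Finset V) :=
  {s | s ∈ X ∧ s.card = q + 1}

/-- The `ZMod 2` simplicial boundary operator on chains (functions from finite
vertex sets to `ZMod 2`): the coefficient of `τ` in `∂c` is the sum of the
coefficients of the sets `τ ∪ {x}`, `x ∉ τ`. -/
noncomputable def sBdry (V : Type*) [Fintype V] [DecidableEq V] :
    (Finset V → ZMod 2) →ₗ[ZMod 2] (Finset V → ZMod 2) :=
  LinearMap.pi fun τ => ∑ x ∈ τᶜ, LinearMap.proj (insert x τ)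

/-- Chains supported on a set `S` of simplices. -/
def sOn {V : Type*} (S : Set (Finset V)) : Submodule (ZMod 2) (Finset V → ZMod 2) :=
  ⨅ s ∈ Sᶜ, LinearMap.ker (LinearMap.proj (R := ZMod 2) (φ := fun _ : Finset V => ZMod 2) s)

/-- The `q`-chains of `X` over `ZMod 2`. -/
def sChains {V : Type*} (X : Set (Finset V)) (q : ℕ) :
    Submodule (ZMod 2) (Finset V → ZMod 2) :=
  sOn (simplices X q)

/-- The `q`-cycles of `X` over `ZMod 2`. -/
noncomputable def sCycles {V : Type*} [Fintype V] [DecidableEq V]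
    (X : Set (Finset V)) (q : ℕ) : Submodule (ZMod 2) (Finset V → ZMod 2) :=
  sChains X q ⊓ LinearMap.ker (sBdry V)

/-- The `q`-boundaries of `X` over `ZMod 2`: boundaries of `(q+1)`-chains. -/
noncomputable def sBdries {V : Type*} [Fintype V] [DecidableEq V]
    (X : Set (Finset V)) (q : ℕ) : Submodule (ZMod 2) (Finset V → ZMod 2) :=
  Submodule.map (sBdry V) (sChains X (q + 1))

/-- The `q`-th simplicial homology of `X` over `ZMod 2`. -/
abbrev sH {V : Type*} [Fintype V] [DecidableEq V] (X : Set (Finset V)) (q : ℕ) :=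
  ↥(sCycles X q) ⧸ ((sBdries X q).comap (sCycles X q).subtype)

/-- Two `q`-simplices (cardinality `q + 1`) share a `(q-1)`-face (of
cardinality `q`). -/
def ShareFace {V : Type*} (q : ℕ) (a b : Finset V) : Prop :=
  a.card = q + 1 ∧ b.card = q + 1 ∧ ∃ t : Finset V, t.card = q ∧ t ⊆ a ∧ t ⊆ b

/-- `q`-connectivity of `q`-simplices in `X`: the reflexive-transitive closure
of sharing a `(q-1)`-face within `X`. -/
def QConn {V : Type*} (X : Set (Finset V)) (q : ℕ) (a b : Finset V) : Prop :=
  Relation.ReflTransGen (fun x y => x ∈ X ∧ y ∈ X ∧ ShareFace q x y) a b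

theorem sBdry_apply {V : Type*} [Fintype V] [DecidableEq V]
    (c : Finset V → ZMod 2) (τ : Finset V) :
    sBdry V c τ = ∑ x ∈ τᶜ, c (insert x τ) := by
  simp [sBdry]

theorem eq_zero_of_mem_sChains {V : Type*} {X : Set (Finset V)} {q : ℕ}
    {c : Finset V → ZMod 2} (hc : c ∈ sChains X q) {s : Finset V}
    (hs : s ∉ simplices X q) : c s = 0 := by
  simp only [sChains, sOn, Submodule.mem_iInf] at hc
  exact hc s hs

/-- If `X₁` and `X₂` cover the support of a `(q+1)`-chain `A` and have no common `q`-simplex, then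
the part of `∂A` in `X₁` is the boundary of the part of `A` in `X₁`. -/
theorem eq_sBdry_restrict {V : Type*} [Fintype V] [DecidableEq V]
    {X X₁ X₂ : Set (Finset V)} {q : ℕ}
    (hX₁ : IsComplex X₁) (hX₂ : IsComplex X₂)
    (hcov : simplices X (q + 1) ⊆ simplices X₁ (q + 1) ∪ simplices X₂ (q + 1))
    (hdisj : Disjoint (simplices X₁ q) (simplices X₂ q))
    {z₁ z₂ A : Finset V → ZMod 2}
    (hz₁ : z₁ ∈ sChains X₁ q) (hz₂ : z₂ ∈ sChains X₂ q)
    (hA : A ∈ sChains X (q + 1)) (hbd : z₁ + z₂ = sBdry V A) :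
    z₁ = sBdry V (fun s => if s ∈ X₁ then A s else 0) := by
  funext τ
  rw [sBdry_apply]
  by_cases hτ : τ ∈ simplices X₁ q
  · have hτ₂ : τ ∉ simplices X₂ q := Set.disjoint_left.mp hdisj hτ
    have h := congrFun hbd τ
    rw [Pi.add_apply, eq_zero_of_mem_sChains hz₂ hτ₂, add_zero, sBdry_apply] at h
    rw [h]
    refine Finset.sum_congr rfl fun x _ => ?_
    split_ifs with hx
    · rfl
    · refine eq_zero_of_mem_sChains hA fun hmem => ?_
      rcases hcov hmem with h₁ | h₂
      · exact hx h₁.1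
      · exact hτ₂ ⟨hX₂ _ h₂.1 _ (Finset.subset_insert x τ), hτ.2⟩
  · rw [eq_zero_of_mem_sChains hz₁ hτ]
    refine (Finset.sum_eq_zero fun x hx => ?_).symm
    split_ifs with hx₁
    · refine eq_zero_of_mem_sChains hA fun hmem => hτ ⟨hX₁ _ hx₁ _ (Finset.subset_insert x τ), ?_⟩
      have hcard := hmem.2
      rw [Finset.card_insert_of_notMem (Finset.mem_compl.mp hx)] at hcard
      omega
    · rfl

/-- with `X₁`, `X₂` as before, if `z₁`, `z₂` are `(q-1)`-cycles of
`X₁`, `X₂` and `z₁ + z₂ = ∂A` for a `q`-chain `A` of `X`, then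
`z₁ = ∂(A ∩ X₁)` and `z₂ = ∂(A ∩ X₂)`. -/
theorem stmt_10 {V : Type*} [Fintype V] [DecidableEq V]
    (X X₁ X₂ : Set (Finset V)) (q : ℕ) (hq : 2 ≤ q)
    (hX : IsComplex X) (hX₁ : IsComplex X₁) (hX₂ : IsComplex X₂)
    (hs₁ : X₁ ⊆ X) (hs₂ : X₂ ⊆ X)
    (hcov₁ : simplices X (q - 1) = simplices X₁ (q - 1) ∪ simplices X₂ (q - 1))
    (hcov₂ : simplices X q = simplices X₁ q ∪ simplices X₂ q)
    (hsep : ∀ a ∈ simplices X₁ (q - 1), ∀ b ∈ simplices X₂ (q - 1),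
      ¬ QConn X (q - 1) a b)
    (z₁ z₂ A : Finset V → ZMod 2)
    (hz₁ : z₁ ∈ sCycles X₁ (q - 1)) (hz₂ : z₂ ∈ sCycles X₂ (q - 1))
    (hA : A ∈ sChains X q) (hbd : z₁ + z₂ = sBdry V A) :
    z₁ = sBdry V (fun s => if s ∈ X₁ then A s else 0) ∧
    z₂ = sBdry V (fun s => if s ∈ X₂ then A s else 0) := by
  obtain ⟨p, rfl⟩ : ∃ p, q = p + 1 := ⟨q - 1, by omega⟩
  simp only [Nat.add_sub_cancel] at hsep hz₁ hz₂
  have hdisj : Disjoint (simplices X₁ p) (simplices X₂ p) :=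
    Set.disjoint_left.mpr fun s h₁ h₂ => hsep s h₁ s h₂ Relation.ReflTransGen.refl
  exact ⟨eq_sBdry_restrict hX₁ hX₂ hcov₂.subset hdisj hz₁.1 hz₂.1 hA hbd,
    eq_sBdry_restrict hX₂ hX₁ (hcov₂.trans (Set.union_comm _ _)).subset hdisj.symm hz₂.1 hz₁.1 hA
      ((add_comm _ _).trans hbd)⟩
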